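/- arXiv:2001.00218 — 4 statements merged into one kernel-verified Lean document; each statement's English description precedes it below -/
import Mathlib

section
/- Let W¹ ∈ ℝ^{m×n}, b¹ ∈ ℝ^m define one ReLU layer and W² ∈ ℝ^{p×m}, b² ∈ ℝ^p define the next ReLU layer, and let D ⊆ ℝ^n. Suppose unit i of the first layer is stably inactive on D, i.e., W¹_i · h + b¹_i < 0 for all h ∈ D. Let W̃¹ ∈ ℝ^{(m−1)×n} and b̃¹ ∈ ℝ^{m−1} be obtained by deleting row i of W¹ and entry i of b¹, and let W̃² ∈ ℝ^{p×(m−1)} be obtained by deleting column i of W². Then for every h ∈ D, relu(W² relu(W¹ h + b¹) + b²) = relu(W̃² relu(W̃¹ h + b̃¹) + b²). -/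
open Matrix

/-- If unit `i` of the first layer is stably inactive on `D`, then deleting row `i`
of `W¹` and entry `i` of `b¹` (here realized by restricting the hidden-unit index
to the subtype `{k // k ≠ i}`), together with deleting column `i` of `W²`, yields a
two-layer network producing the same output on `D`. -/
theorem remove_stably_inactive_unit {n m p : ℕ}
    (W1 : Matrix (Fin m) (Fin n) ℝ) (b1 : Fin m → ℝ)
    (W2 : Matrix (Fin p) (Fin m) ℝ) (b2 : Fin p → ℝ)
    (D : Set (Fin n → ℝ)) (i : Fin m)
    (hstable : ∀ h ∈ D, W1 i ⬝ᵥ h + b1 i < 0) :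
    ∀ h ∈ D,
      (fun j : Fin p =>
        max 0 (W2.mulVec (fun k : Fin m => max 0 (W1.mulVec h k + b1 k)) j + b2 j))
      =
      (fun j : Fin p =>
        max 0 ((Matrix.of fun (j : Fin p) (k : {k : Fin m // k ≠ i}) => W2 j k.1).mulVec
            (fun k : {k : Fin m // k ≠ i} => max 0 (W1 k.1 ⬝ᵥ h + b1 k.1)) j + b2 j)) := by
  intro h hh
  funext j
  have hi : max 0 (W1.mulVec h i + b1 i) = 0 := max_eq_left (hstable h hh).le
  congr 2
  simp only [Matrix.mulVec, dotProduct, Matrix.of_apply] at hi ⊢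
  rw [Fintype.sum_eq_add_sum_subtype_ne _ i, hi, mul_zero, zero_add]
end

section
/- Let W¹ ∈ ℝ^{m×n}, b¹ ∈ ℝ^m define one ReLU layer and W² ∈ ℝ^{p×m}, b² ∈ ℝ^p define the next ReLU layer, and let D ⊆ ℝ^n. Let S be a set of unit indices of the first layer and i ∉ S, suppose every unit in S ∪ {i} is stably active on D (W¹_k · h + b¹_k > 0 for all h ∈ D, k ∈ S ∪ {i}), and suppose W¹_i = Σ_{k ∈ S} α_k W¹_k for real coefficients (α_k)_{k ∈ S}. Define the compressed network by deleting row i of W¹ and entry i of b¹, deleting column i of W², replacing W²_{j k} by W²_{j k} + α_k W²_{j i} for each j and each k ∈ S, and replacing b²_j by b²_j + W²_{j i} (b¹_i − Σ_{k ∈ S} α_k b¹_k) for each j. Then for every h ∈ D the compressed two-layer map produces the same output as relu(W² relu(W¹ h + b¹) + b²). -/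
open Matrix

/-- Merging a stably active unit whose weight row is linearly dependent on those of
the stably active units in `S`: delete row `i` of `W¹` and entry `i` of `b¹`
(realized by restricting the hidden index to `{k // k ≠ i}`), delete column `i` of
`W²`, replace `W² j k` by `W² j k + α k * W² j i` for `k ∈ S`, and replace `b² j` by
`b² j + W² j i * (b¹ i - ∑ k ∈ S, α k * b¹ k)`.  The compressed two-layer network
produces the same output as the original one for every input in `D`. -/
theorem merge_stably_active_unit {n m p : ℕ}
    (W1 : Matrix (Fin m) (Fin n) ℝ) (b1 : Fin m → ℝ)
    (W2 : Matrix (Fin p) (Fin m) ℝ) (b2 : Fin p → ℝ)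
    (D : Set (Fin n → ℝ)) (S : Finset (Fin m)) (i : Fin m) (hi : i ∉ S)
    (α : Fin m → ℝ)
    (hstable : ∀ h ∈ D, ∀ k ∈ insert i S, 0 < W1 k ⬝ᵥ h + b1 k)
    (hdep : W1 i = ∑ k ∈ S, α k • W1 k) :
    ∀ h ∈ D,
      (fun j : Fin p =>
        max 0 (W2.mulVec (fun k : Fin m => max 0 (W1.mulVec h k + b1 k)) j + b2 j))
      =
      (fun j : Fin p =>
        max 0 ((Matrix.of fun (j : Fin p) (k : {k : Fin m // k ≠ i}) =>
              if k.1 ∈ S then W2 j k.1 + α k.1 * W2 j i else W2 j k.1).mulVec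
            (fun k : {k : Fin m // k ≠ i} => max 0 (W1 k.1 ⬝ᵥ h + b1 k.1)) j
          + (b2 j + W2 j i * (b1 i - ∑ k ∈ S, α k * b1 k)))) := by
  intro h hh
  have hrow : W1 i ⬝ᵥ h = ∑ k ∈ S, α k * (W1 k ⬝ᵥ h) := by
    rw [hdep, sum_dotProduct]
    simp only [smul_dotProduct, smul_eq_mul]
  have hact : ∀ k ∈ insert i S, max 0 (W1 k ⬝ᵥ h + b1 k) = W1 k ⬝ᵥ h + b1 k :=
    fun k hk => max_eq_right (hstable h hh k hk).le
  funext j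
  congr 1
  have hmerge : ∑ k : Fin m, (if k ∈ S then W2 j k + α k * W2 j i else W2 j k) *
        max 0 (W1 k ⬝ᵥ h + b1 k) =
      ∑ k : Fin m, W2 j k * max 0 (W1 k ⬝ᵥ h + b1 k) +
        W2 j i * (W1 i ⬝ᵥ h + ∑ k ∈ S, α k * b1 k) := by
    have hS : W2 j i * (W1 i ⬝ᵥ h + ∑ k ∈ S, α k * b1 k) =
        ∑ k : Fin m, if k ∈ S then α k * W2 j i * max 0 (W1 k ⬝ᵥ h + b1 k) else 0 := by
      rw [Finset.sum_ite_mem, Finset.univ_inter, hrow, ← Finset.sum_add_distrib,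
        Finset.mul_sum]
      refine Finset.sum_congr rfl fun k hk => ?_
      rw [hact k (Finset.mem_insert_of_mem hk)]
      ring
    rw [hS, ← Finset.sum_add_distrib]
    refine Finset.sum_congr rfl fun k _ => ?_
    split_ifs <;> ring
  rw [Fintype.sum_eq_add_sum_subtype_ne _ i, if_neg hi,
    hact i (Finset.mem_insert_self i S)] at hmerge
  simp only [mulVec, dotProduct, of_apply] at hmerge ⊢
  linarith
end

section
/- Let W¹ ∈ ℝ^{m×n}, b¹ ∈ ℝ^m define one ReLU layer and W² ∈ ℝ^{p×m}, b² ∈ ℝ^p define the next ReLU layer, and let D ⊆ ℝ^n. Suppose every unit of the first layer is stably active on D, i.e., W¹_k · h + b¹_k > 0 for all h ∈ D and all k ∈ {1,…,m}. Then for every h ∈ D, relu(W² relu(W¹ h + b¹) + b²) = relu(W̄ h + b̄), where W̄ = W² W¹ ∈ ℝ^{p×n} is the matrix product and b̄ = W² b¹ + b² ∈ ℝ^p; that is, the stably active layer can be folded away. -/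
open Matrix

/-- If every unit of the first layer is stably active on `D`, the layer can be
folded away: the two-layer map equals the single ReLU layer with weights
`W̄ = W² * W¹` and biases `b̄ = W² *ᵥ b¹ + b²` on `D`. -/
theorem fold_stably_active_layer {n m p : ℕ}
    (W1 : Matrix (Fin m) (Fin n) ℝ) (b1 : Fin m → ℝ)
    (W2 : Matrix (Fin p) (Fin m) ℝ) (b2 : Fin p → ℝ)
    (D : Set (Fin n → ℝ))
    (hstable : ∀ h ∈ D, ∀ k : Fin m, 0 < W1 k ⬝ᵥ h + b1 k) :
    ∀ h ∈ D,
      (fun j : Fin p =>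
        max 0 (W2.mulVec (fun k : Fin m => max 0 (W1.mulVec h k + b1 k)) j + b2 j))
      =
      (fun j : Fin p =>
        max 0 ((W2 * W1).mulVec h j + (W2.mulVec b1 + b2) j)) := by
  intro h hh
  have hrelu : (fun k : Fin m => max 0 (W1.mulVec h k + b1 k)) = W1.mulVec h + b1 :=
    funext fun k => max_eq_right (hstable h hh k).le
  funext j
  rw [hrelu, Matrix.mulVec_add, Matrix.mulVec_mulVec, Pi.add_apply, Pi.add_apply, add_assoc]
end

section
/- Let g, h, h̄ ∈ ℝ, z ∈ {0, 1}, and H, H̄ > 0 satisfy the MILP constraints: g = h − h̄, h ≤ H z, h̄ ≤ H̄ (1 − z), h ≥ 0, and h̄ ≥ 0. Then h = max(0, g) and h̄ = max(0, −g). -/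
/-- The MILP constraints (2)–(7) modelling a ReLU unit force the intended values:
if `g = h - h̄`, `h ≤ H z`, `h̄ ≤ H̄ (1 - z)`, `h ≥ 0`, `h̄ ≥ 0` with `z ∈ {0, 1}`
and `H, H̄ > 0`, then `h = max 0 g` and `h̄ = max 0 (-g)`. -/
theorem milp_relu_constraints_force_relu
    (g h hbar z H Hbar : ℝ)
    (hz : z = 0 ∨ z = 1) (hH : 0 < H) (hHbar : 0 < Hbar)
    (c1 : g = h - hbar)
    (c2 : h ≤ H * z)
    (c3 : hbar ≤ Hbar * (1 - z))
    (c4 : 0 ≤ h)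
    (c5 : 0 ≤ hbar) :
    h = max 0 g ∧ hbar = max 0 (-g) := by
  rcases hz with rfl | rfl
  · obtain rfl : h = 0 := by linarith
    constructor
    · rw [max_eq_left] <;> linarith
    · rw [max_eq_right] <;> linarith
  · obtain rfl : hbar = 0 := by linarith
    constructor
    · rw [max_eq_right] <;> linarith
    · rw [max_eq_left] <;> linarith
end
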